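/- arXiv:1712.03447 — 5 statements merged into one kernel-verified Lean document; each statement's English description precedes it below -/
import Mathlib

section
/- Suppose F ⊆ Sym²(ℝⁿ) is a convex cone subequation and W ⊆ ℝⁿ is a subspace with F₊ ⊆ Sym²(W). Then F = F_W ⊕ Sym²(W)^⊥: identifying F_W with {P_W A P_W : A ∈ F} ⊆ Sym²(W) ⊆ Sym²(ℝⁿ), a matrix A belongs to F if and only if P_W A P_W ∈ F_W, i.e., F = {B + C : B ∈ F_W, C ∈ Sym²(W)^⊥}. Moreover Sym²(W)^⊥ ⊆ E, the edge of F. -/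
open Matrix Set Pointwise

noncomputable section

/-- `Sym²(ℝⁿ)`: the space of real symmetric `n × n` matrices,
realized as the self-adjoint elements of the matrix algebra. -/
abbrev SymMat (n : ℕ) : Type := ↥(selfAdjoint (Matrix (Fin n) (Fin n) ℝ))

namespace SymMat

variable {n : ℕ}

/-- The trace inner product `⟨A, B⟩ = tr (A * B)` on `Sym²(ℝⁿ)`. -/
def tinner (A B : SymMat n) : ℝ :=
  ((A : Matrix (Fin n) (Fin n) ℝ) * (B : Matrix (Fin n) (Fin n) ℝ)).trace

/-- `𝒫`: the closed convex cone of positive semidefinite matrices. -/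
def Psd (n : ℕ) : Set (SymMat n) :=
  {A | (A : Matrix (Fin n) (Fin n) ℝ).PosSemidef}

/-- The set of positive definite matrices (= `Int 𝒫`). -/
def Pd (n : ℕ) : Set (SymMat n) :=
  {A | (A : Matrix (Fin n) (Fin n) ℝ).PosDef}

/-- A convex cone subequation: a closed convex cone `F ⊆ Sym²(ℝⁿ)` which is a nonempty
proper subset and satisfies the positivity condition `F + 𝒫 = F`. -/
structure IsSubequation (F : Set (SymMat n)) : Prop where
  nonempty : F.Nonempty
  proper : F ≠ Set.univ
  isClosed : IsClosed F
  convex : Convex ℝ F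
  cone : ∀ t : ℝ, 0 ≤ t → ∀ A ∈ F, t • A ∈ F
  positivity : ∀ A ∈ F, ∀ P ∈ Psd n, A + P ∈ F

/-- The polar cone `F₊ = {B : ⟨A,B⟩ ≥ 0 ∀ A ∈ F}`. -/
def polarCone (F : Set (SymMat n)) : Set (SymMat n) :=
  {B | ∀ A ∈ F, 0 ≤ tinner A B}

/-- The edge `E = F ∩ (−F)`. -/
def edge (F : Set (SymMat n)) : Set (SymMat n) := F ∩ (-F)

/-- Orthogonal complement (as a set) with respect to the trace inner product. -/
def orthSet (E : Set (SymMat n)) : Set (SymMat n) :=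
  {B | ∀ A ∈ E, tinner A B = 0}

/-- `P_e = e eᵀ`, orthogonal projection onto the line spanned by `e`, as a symmetric matrix. -/
def lineProj (e : EuclideanSpace ℝ (Fin n)) : SymMat n :=
  ⟨Matrix.vecMulVec (WithLp.equiv 2 (Fin n → ℝ) e) (WithLp.equiv 2 (Fin n → ℝ) e), by
    refine selfAdjoint.mem_iff.mpr ?_
    ext i j
    simp [Matrix.conjTranspose_apply, Matrix.vecMulVec_apply, mul_comm]⟩

/-- The matrix `P_W` of the orthogonal projection onto a subspace `W ⊆ ℝⁿ`. -/
def projMat (W : Submodule ℝ (EuclideanSpace ℝ (Fin n))) : Matrix (Fin n) (Fin n) ℝ :=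
  Matrix.toEuclideanLin.symm ((W.subtypeL.comp (Submodule.orthogonalProjectionOnto W)).toLinearMap)

/-- `Sym²(W) = {A : A = P_W A P_W}`. -/
def symOn (W : Submodule ℝ (EuclideanSpace ℝ (Fin n))) : Set (SymMat n) :=
  {A | (A : Matrix (Fin n) (Fin n) ℝ) = projMat W * A * projMat W}

/-- The restriction `F_W = {P_W A P_W : A ∈ F}` of `F` to `W` (inside `Sym²(W)`). -/
def restrictTo (F : Set (SymMat n)) (W : Submodule ℝ (EuclideanSpace ℝ (Fin n))) :
    Set (SymMat n) :=
  {B | ∃ A ∈ F, (B : Matrix (Fin n) (Fin n) ℝ) = projMat W * A * projMat W}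

/-- `F` is extremely degenerate: the polar cone only involves the variables of some
proper subspace `W ⊊ ℝⁿ`. -/
def IsExtremelyDegenerate (F : Set (SymMat n)) : Prop :=
  ∃ W : Submodule ℝ (EuclideanSpace ℝ (Fin n)), W ≠ ⊤ ∧ polarCone F ⊆ symOn W

/-- `F` is (dimensionally) complete. -/
def IsComplete (F : Set (SymMat n)) : Prop := ¬ IsExtremelyDegenerate F

/-- The interior of `F` relative to `S`. -/
def relInt (S F : Set (SymMat n)) : Set (SymMat n) :=
  {B | B ∈ S ∧ ∃ U : Set (SymMat n), IsOpen U ∧ B ∈ U ∧ U ∩ S ⊆ F}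

/-- The support of `F`: the intersection of all subspaces `W'` with `F₊ ⊆ Sym²(W')`. -/
def support (F : Set (SymMat n)) : Submodule ℝ (EuclideanSpace ℝ (Fin n)) :=
  sInf {W | polarCone F ⊆ symOn W}

/-- The polar cone of `G` taken within `Sym²(W)`. -/
def polarIn (G : Set (SymMat n)) (W : Submodule ℝ (EuclideanSpace ℝ (Fin n))) :
    Set (SymMat n) :=
  {B | B ∈ symOn W ∧ ∀ A ∈ G, 0 ≤ tinner A B}

end SymMat

namespace SymMat

theorem projMat_transpose {n : ℕ} (W : Submodule ℝ (EuclideanSpace ℝ (Fin n))) :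
    (projMat W)ᵀ = projMat W := by
  have h : (Matrix.toEuclideanLin (projMat W)).IsSymmetric := by
    rw [projMat, LinearEquiv.apply_symm_apply]
    exact Submodule.starProjection_isSymmetric W
  have := Matrix.isSymmetric_toEuclideanLin_iff.1 h
  simpa [Matrix.IsHermitian] using this

theorem projMat_mul_self {n : ℕ} (W : Submodule ℝ (EuclideanSpace ℝ (Fin n))) :
    projMat W * projMat W = projMat W := by
  apply Matrix.toEuclideanLin.injective
  ext1 x
  have h : ∀ y, Matrix.toEuclideanLin (projMat W) y = W.starProjection y := by
    intro y
    rw [projMat, LinearEquiv.apply_symm_apply]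
    rfl
  have h2 : Matrix.toEuclideanLin (projMat W * projMat W) x
      = Matrix.toEuclideanLin (projMat W) (Matrix.toEuclideanLin (projMat W) x) := by
    simp [Matrix.toLpLin_apply, Matrix.mulVec_mulVec]
  rw [h2]
  simp only [h]
  exact Submodule.starProjection_eq_self_iff.2 (Submodule.starProjection_apply_mem W x)

theorem val_transpose {n : ℕ} (A : SymMat n) :
    (A : Matrix (Fin n) (Fin n) ℝ)ᵀ = A := by
  have := selfAdjoint.mem_iff.1 A.2
  rwa [Matrix.star_eq_conjTranspose, Matrix.conjTranspose_eq_transpose_of_trivial] at this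

/-- The compression `P_W A P_W` as a symmetric matrix. -/
def compress {n : ℕ} (W : Submodule ℝ (EuclideanSpace ℝ (Fin n))) (A : SymMat n) : SymMat n :=
  ⟨projMat W * A * projMat W, by
    refine selfAdjoint.mem_iff.mpr ?_
    rw [Matrix.star_eq_conjTranspose, Matrix.conjTranspose_eq_transpose_of_trivial,
      Matrix.transpose_mul, Matrix.transpose_mul, projMat_transpose, val_transpose,
      Matrix.mul_assoc]⟩

theorem tinner_compress {n : ℕ} (W : Submodule ℝ (EuclideanSpace ℝ (Fin n))) (A D : SymMat n)
    (hD : D ∈ symOn W) : tinner (compress W A) D = tinner A D := by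
  have hD' : (D : Matrix (Fin n) (Fin n) ℝ) = projMat W * D * projMat W := hD
  unfold tinner compress
  conv_rhs => rw [hD']
  simp only [Matrix.mul_assoc]
  rw [Matrix.trace_mul_comm]
  simp only [Matrix.mul_assoc]

theorem tinner_add {n : ℕ} (A B D : SymMat n) :
    tinner (A + B) D = tinner A D + tinner B D := by
  simp [tinner, Matrix.add_mul]

theorem tinner_neg {n : ℕ} (A D : SymMat n) : tinner (-A) D = -tinner A D := by
  simp [tinner]

theorem tinner_comm {n : ℕ} (A B : SymMat n) : tinner A B = tinner B A :=
  Matrix.trace_mul_comm _ _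

theorem exists_rep {n : ℕ} (f : Matrix (Fin n) (Fin n) ℝ →ₗ[ℝ] ℝ) :
    ∃ B : SymMat n, ∀ A : SymMat n, f A = tinner A B := by
  let B0 : Matrix (Fin n) (Fin n) ℝ := Matrix.of fun i j => f (Matrix.single j i 1)
  have h0 : ∀ M, f M = (M * B0).trace := by
    intro M
    conv_lhs => rw [Matrix.matrix_eq_sum_single M]
    simp only [map_sum, Matrix.trace, Matrix.diag, Matrix.mul_apply]
    refine Finset.sum_congr rfl fun i _ => Finset.sum_congr rfl fun j _ => ?_
    have : Matrix.single i j (M i j) = M i j • Matrix.single i j (1:ℝ) := by simp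
    rw [this, map_smul]; rfl
  refine ⟨⟨(1/2 : ℝ) • (B0 + B0ᵀ), ?_⟩, fun A => ?_⟩
  · refine selfAdjoint.mem_iff.mpr ?_
    rw [Matrix.star_eq_conjTranspose, Matrix.conjTranspose_eq_transpose_of_trivial]
    simp [add_comm]
  · have h1 : ((A : Matrix (Fin n) (Fin n) ℝ) * B0ᵀ).trace = (A * B0).trace := by
      rw [← Matrix.trace_transpose, Matrix.transpose_mul, val_transpose, Matrix.transpose_transpose,
        Matrix.trace_mul_comm]
    simp only [tinner, Matrix.mul_smul, Matrix.mul_add, Matrix.trace_smul, Matrix.trace_add, h1, h0]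
    simp only [smul_eq_mul]; ring

theorem mem_of_polar {n : ℕ} {F : Set (SymMat n)} (hF : IsSubequation F) (A : SymMat n)
    (h : ∀ D ∈ polarCone F, 0 ≤ tinner A D) : A ∈ F := by
  by_contra hA
  let G : Set (Matrix (Fin n) (Fin n) ℝ) := Subtype.val '' F
  have hcl : IsClosed (selfAdjoint (Matrix (Fin n) (Fin n) ℝ) : Set (Matrix (Fin n) (Fin n) ℝ)) := by
    have : (selfAdjoint (Matrix (Fin n) (Fin n) ℝ) : Set (Matrix (Fin n) (Fin n) ℝ))
      = {M | star M = M} := by ext M; exact selfAdjoint.mem_iff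
    rw [this]
    exact isClosed_eq continuous_star continuous_id
  have hGc : IsClosed G := hcl.isClosedEmbedding_subtypeVal.isClosedMap _ hF.isClosed
  have hGv : Convex ℝ G := by
    rintro _ ⟨x, hx, rfl⟩ _ ⟨y, hy, rfl⟩ a b ha hb hab
    exact ⟨a • x + b • y, hF.convex hx hy ha hb hab, by simp⟩
  have hAG : (A : Matrix (Fin n) (Fin n) ℝ) ∉ G := by
    rintro ⟨x, hx, hxA⟩
    exact hA (Subtype.ext hxA ▸ hx)
  haveI : LocallyConvexSpace ℝ (Matrix (Fin n) (Fin n) ℝ) :=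
    inferInstanceAs (LocallyConvexSpace ℝ (Fin n → Fin n → ℝ))
  obtain ⟨f, u, hfu, huF⟩ := geometric_hahn_banach_point_closed hGv hGc hAG
  obtain ⟨B, hB⟩ := exists_rep (f : Matrix (Fin n) (Fin n) ℝ →ₗ[ℝ] ℝ)
  have hB' : ∀ X : SymMat n, f X = tinner X B := hB
  have hu0 : u < 0 := by
    obtain ⟨x, hx⟩ := hF.nonempty
    have := huF _ ⟨_, hF.cone 0 le_rfl x hx, rfl⟩
    simpa using this
  have hBp : B ∈ polarCone F := by
    intro X hX
    by_contra hneg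
    push Not at hneg
    have := huF _ ⟨_, hF.cone (u / tinner X B) (div_nonneg_of_nonpos hu0.le hneg.le) X hX, rfl⟩
    rw [selfAdjoint.val_smul, map_smul, hB', smul_eq_mul, div_mul_cancel₀ _ hneg.ne] at this
    exact lt_irrefl _ this
  have := h B hBp
  rw [hB'] at hfu
  linarith

end SymMat

open SymMat in
theorem degenerate_decomposition {n : ℕ} (F : Set (SymMat n))
    (hF : IsSubequation F) (W : Submodule ℝ (EuclideanSpace ℝ (Fin n)))
    (hW : polarCone F ⊆ symOn W) :
    (∀ A : SymMat n, A ∈ F ↔ ∃ B ∈ restrictTo F W,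
        (B : Matrix (Fin n) (Fin n) ℝ) = projMat W * A * projMat W) ∧
    F = restrictTo F W + orthSet (symOn W) ∧
    orthSet (symOn W) ⊆ edge F := by
  have key : ∀ A, ∀ A' ∈ F, ∀ C ∈ orthSet (symOn W),
      (∀ D ∈ symOn W, tinner A D = tinner A' D + tinner C D) → A ∈ F := by
    intro A A' hA' C hC h
    refine mem_of_polar hF A fun D hD => ?_
    rw [h D (hW hD), tinner_comm C, hC D (hW hD), add_zero]
    exact hD A' hA'
  have h0 : ∀ D : SymMat n, tinner 0 D = 0 := fun D => by simp [tinner]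
  have h0orth : (0 : SymMat n) ∈ orthSet (symOn W) := fun D _ => by rw [tinner_comm, h0]
  have h0F : (0 : SymMat n) ∈ F := by
    obtain ⟨x, hx⟩ := hF.nonempty
    simpa using hF.cone 0 le_rfl x hx
  refine ⟨fun A => ⟨fun hA => ⟨compress W A, ⟨A, hA, rfl⟩, rfl⟩, ?_⟩, ?_, ?_⟩
  · rintro ⟨B, ⟨A', hA', hBA'⟩, hBA⟩
    refine key A A' hA' 0 h0orth fun D hD => ?_
    have e : compress W A = compress W A' := Subtype.ext (hBA.symm.trans hBA')
    rw [h0, add_zero, ← tinner_compress W A D hD, e, tinner_compress W A' D hD]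
  · ext A
    rw [Set.mem_add]
    constructor
    · intro hA
      refine ⟨compress W A, ⟨A, hA, rfl⟩, A - compress W A, fun D hD => ?_, by abel⟩
      rw [tinner_comm, sub_eq_add_neg, tinner_add, tinner_neg, tinner_compress W A D hD]
      ring
    · rintro ⟨B, ⟨A', hA', hB⟩, C, hC, rfl⟩
      refine key _ A' hA' C hC fun D hD => ?_
      have e : B = compress W A' := Subtype.ext hB
      rw [tinner_add, e, tinner_compress W A' D hD]
  · intro C hC
    refine ⟨key C 0 h0F C hC fun D _ => by rw [h0, zero_add], ?_⟩
    rw [Set.mem_neg]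
    refine key (-C) 0 h0F (-C) (fun D hD => ?_) fun D _ => by rw [h0, zero_add]
    rw [tinner_comm, tinner_neg, tinner_comm, hC D hD, neg_zero]
end
end

section
/- Let F ⊆ Sym²(ℝⁿ) be a convex cone subequation with edge E = F ∩ (−F) and polar cone F₊, and let W ⊆ ℝⁿ be a hyperplane with unit normal vector e. Then P_e ∈ E if and only if F₊ ⊆ Sym²(W). -/
open Matrix Set Pointwise

noncomputable section

namespace SymMat

variable {n : ℕ}

/-- The trace inner product with `lineProj e` is the quadratic form at `e`. -/
lemma aux_tinner_lineProj (e : EuclideanSpace ℝ (Fin n)) (B : SymMat n) :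
    tinner (lineProj e) B = e.ofLp ⬝ᵥ (B : Matrix (Fin n) (Fin n) ℝ) *ᵥ e.ofLp := by
  change (vecMulVec e.ofLp e.ofLp * (B : Matrix (Fin n) (Fin n) ℝ)).trace = _
  rw [vecMulVec_mul, trace_vecMulVec, dotProduct_comm, dotProduct_mulVec]

/-- The projection matrix onto the hyperplane normal to a unit vector. -/
lemma aux_projMat (e : EuclideanSpace ℝ (Fin n)) (he : ‖e‖ = 1) :
    projMat (Submodule.span ℝ {e})ᗮ = 1 - vecMulVec e.ofLp e.ofLp := by
  unfold projMat
  rw [LinearEquiv.symm_apply_eq]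
  refine LinearMap.ext fun w => ?_
  change (Submodule.span ℝ {e})ᗮ.starProjection w = _
  rw [Submodule.starProjection_orthogonal_val, Submodule.starProjection_unit_singleton ℝ he]
  ext i
  rw [toEuclideanLin_apply]
  simp [sub_mulVec, vecMulVec_mulVec, EuclideanSpace.inner_eq_star_dotProduct, dotProduct_comm]

lemma aux_dot_self (e : EuclideanSpace ℝ (Fin n)) (he : ‖e‖ = 1) :
    e.ofLp ⬝ᵥ e.ofLp = 1 := by
  have h := real_inner_self_eq_norm_sq e
  rw [EuclideanSpace.inner_eq_star_dotProduct, he] at h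
  simpa using h

lemma aux_isSymm (B : SymMat n) :
    (B : Matrix (Fin n) (Fin n) ℝ)ᵀ = (B : Matrix (Fin n) (Fin n) ℝ) := by
  have h := selfAdjoint.mem_iff.mp B.2
  rwa [star_eq_conjTranspose, conjTranspose_eq_transpose_of_trivial] at h

lemma aux_mem_symOn (e : EuclideanSpace ℝ (Fin n)) (he : ‖e‖ = 1) (B : SymMat n) :
    B ∈ symOn (Submodule.span ℝ {e})ᗮ ↔
      (B : Matrix (Fin n) (Fin n) ℝ) *ᵥ e.ofLp = 0 := by
  change (B : Matrix (Fin n) (Fin n) ℝ) = _ ↔ _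
  rw [aux_projMat e he]
  constructor
  · intro h
    rw [h, ← mulVec_mulVec, sub_mulVec, vecMulVec_mulVec, aux_dot_self e he]
    simp
  · intro h
    have h' : e.ofLp ᵥ* (B : Matrix (Fin n) (Fin n) ℝ) = 0 := by
      rw [← mulVec_transpose, aux_isSymm, h]
    rw [sub_mul, vecMulVec_mul, h', mul_sub, sub_mul, mul_vecMulVec]
    simp [h]

lemma aux_zero_mem {F : Set (SymMat n)} (hF : IsSubequation F) : (0 : SymMat n) ∈ F := by
  obtain ⟨A, hA⟩ := hF.nonempty
  simpa using hF.cone 0 le_rfl A hA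

lemma aux_psd_subset {F : Set (SymMat n)} (hF : IsSubequation F) : Psd n ⊆ F := by
  intro P hP
  simpa using hF.positivity 0 (aux_zero_mem hF) P hP

lemma aux_lineProj_psd (e : EuclideanSpace ℝ (Fin n)) : lineProj e ∈ Psd n := by
  have h := posSemidef_vecMulVec_self_star e.ofLp
  rwa [star_trivial] at h

lemma aux_polar_psd {F : Set (SymMat n)} (hF : IsSubequation F) :
    polarCone F ⊆ Psd n := by
  intro B hB
  refine PosSemidef.of_dotProduct_mulVec_nonneg (selfAdjoint.mem_iff.mp B.2) fun x => ?_
  have h := hB _ (aux_psd_subset hF (aux_lineProj_psd (WithLp.toLp 2 x)))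
  rw [aux_tinner_lineProj] at h
  simpa using h

/-- The trace form as a bilinear form. -/
def auxForm (n : ℕ) : SymMat n →ₗ[ℝ] SymMat n →ₗ[ℝ] ℝ :=
  LinearMap.mk₂ ℝ (fun B A => tinner A B)
    (by intro a b c; simp [tinner, mul_add])
    (by intro a b c; simp [tinner])
    (by intro a b c; simp [tinner, add_mul])
    (by intro a b c; simp [tinner])

instance auxFinite : FiniteDimensional ℝ (SymMat n) :=
  inferInstanceAs (FiniteDimensional ℝ (selfAdjoint.submodule ℝ (Matrix (Fin n) (Fin n) ℝ)))

lemma aux_repr (f : SymMat n →ₗ[ℝ] ℝ) : ∃ B : SymMat n, ∀ A, f A = tinner A B := by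
  have hinj : Function.Injective (auxForm n) := by
    rw [injective_iff_map_eq_zero]
    intro B hB
    have h : tinner B B = 0 := LinearMap.congr_fun hB B
    apply Subtype.ext
    change (B : Matrix (Fin n) (Fin n) ℝ) = 0
    rw [← trace_conjTranspose_mul_self_eq_zero_iff,
      conjTranspose_eq_transpose_of_trivial, aux_isSymm]
    exact h
  have hsurj : Function.Surjective (auxForm n) :=
    (LinearMap.injective_iff_surjective_of_finrank_eq_finrank
      (Subspace.dual_finrank_eq (K := ℝ) (V := SymMat n)).symm).1 hinj
  obtain ⟨B, hB⟩ := hsurj f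
  exact ⟨B, fun A => by rw [← hB]; rfl⟩

lemma aux_lcs : LocallyConvexSpace ℝ (SymMat n) := by
  have : LocallyConvexSpace ℝ (Matrix (Fin n) (Fin n) ℝ) :=
    inferInstanceAs (LocallyConvexSpace ℝ (Fin n → Fin n → ℝ))
  exact inferInstanceAs
    (LocallyConvexSpace ℝ (selfAdjoint.submodule ℝ (Matrix (Fin n) (Fin n) ℝ)))

/-- Bipolar theorem, in separation form. -/
lemma aux_separate {F : Set (SymMat n)} (hF : IsSubequation F) {X : SymMat n} (hX : X ∉ F) :
    ∃ B ∈ polarCone F, tinner X B < 0 := by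
  have := aux_lcs (n := n)
  have : ContinuousSMul ℝ (SymMat n) := inferInstanceAs
    (ContinuousSMul ℝ (selfAdjoint.submodule ℝ (Matrix (Fin n) (Fin n) ℝ)))
  obtain ⟨f, u, hu, hf⟩ := geometric_hahn_banach_point_closed hF.convex hF.isClosed hX
  obtain ⟨B, hB⟩ := aux_repr (f : SymMat n →ₗ[ℝ] ℝ)
  have hB' : ∀ A, f A = tinner A B := hB
  have hu0 : u < 0 := by simpa using hf 0 (aux_zero_mem hF)
  refine ⟨B, fun A hA => ?_, ?_⟩
  · rw [← hB']
    by_contra! hneg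
    have h := hf _ (hF.cone (u / f A) (div_nonneg_of_nonpos hu0.le hneg.le) A hA)
    rw [map_smul, smul_eq_mul, div_mul_cancel₀ _ hneg.ne] at h
    exact lt_irrefl _ h
  · rw [← hB']
    linarith

lemma aux_tinner_neg (A B : SymMat n) : tinner (-A) B = - tinner A B := by
  simp [tinner]

end SymMat

open SymMat in
theorem lineProj_mem_edge_iff {n : ℕ} (F : Set (SymMat n))
    (hF : IsSubequation F) (e : EuclideanSpace ℝ (Fin n)) (he : ‖e‖ = 1) :
    lineProj e ∈ edge F ↔ polarCone F ⊆ symOn (Submodule.span ℝ {e})ᗮ := by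
  constructor
  · rintro ⟨h1, h2⟩ B hB
    rw [aux_mem_symOn e he]
    have hp := aux_polar_psd hF hB
    have a := hB _ h1
    have b := hB _ (Set.mem_neg.mp h2)
    rw [aux_tinner_neg] at b
    have c : tinner (lineProj e) B = 0 := by linarith
    rw [aux_tinner_lineProj] at c
    rw [← PosSemidef.dotProduct_mulVec_zero_iff hp, star_trivial]
    exact c
  · intro h
    refine ⟨aux_psd_subset hF (aux_lineProj_psd e), Set.mem_neg.mpr ?_⟩
    by_contra hX
    obtain ⟨B, hB, hlt⟩ := aux_separate hF hX
    have h0 := (aux_mem_symOn e he B).1 (h hB)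
    rw [aux_tinner_neg, aux_tinner_lineProj, h0] at hlt
    simp at hlt
end
end

section
/- Let F ⊆ Sym²(ℝⁿ) be a convex cone subequation with edge E = F ∩ (−F). Suppose P ∈ 𝒫 is positive semidefinite with kernel (null space) N ⊆ ℝⁿ. If P ∈ E, then Sym²(N^⊥) ⊆ E. -/
open Matrix Set Pointwise

noncomputable section

/-- Every square matrix has a generalized inverse. -/
theorem exists_ginv {n : ℕ} (R : Matrix (Fin n) (Fin n) ℝ) :
    ∃ G : Matrix (Fin n) (Fin n) ℝ, R * G * R = R := by
  obtain ⟨g, hg⟩ := (Matrix.toLin' R).rangeRestrict.exists_rightInverse_of_surjective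
    (LinearMap.range_rangeRestrict _)
  obtain ⟨h, hh⟩ := LinearMap.exists_extend g
  refine ⟨LinearMap.toMatrix' h, ?_⟩
  apply Matrix.toLin'.injective
  rw [Matrix.toLin'_mul, Matrix.toLin'_mul, Matrix.toLin'_toMatrix']
  refine LinearMap.ext fun x => ?_
  have h1 := LinearMap.congr_fun hh ((Matrix.toLin' R).rangeRestrict x)
  have h2 := congrArg Subtype.val
    (LinearMap.congr_fun hg ((Matrix.toLin' R).rangeRestrict x))
  simp only [LinearMap.comp_apply, Submodule.subtype_apply, LinearMap.codRestrict_apply,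
    LinearMap.rangeRestrict, LinearMap.id_apply] at h1 h2 ⊢
  rw [h1]
  exact h2

/-- Adding a large multiple of the identity makes a symmetric matrix positive semidefinite. -/
theorem exists_shift_posSemidef {n : ℕ} (B : Matrix (Fin n) (Fin n) ℝ) (hB : B.IsHermitian) :
    ∃ t : ℝ, 0 ≤ t ∧ (t • (1 : Matrix (Fin n) (Fin n) ℝ) + B).PosSemidef := by
  refine ⟨‖Matrix.toEuclideanCLM (n := Fin n) (𝕜 := ℝ) B‖, norm_nonneg _, ?_⟩
  refine .of_dotProduct_mulVec_nonneg ?_ fun x => ?_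
  · refine Matrix.IsHermitian.add ?_ hB
    simp [Matrix.IsHermitian]
  · set T := Matrix.toEuclideanCLM (n := Fin n) (𝕜 := ℝ) B with hT
    set y : EuclideanSpace ℝ (Fin n) := WithLp.toLp 2 x with hy
    have h1 : |inner ℝ (T y) y| ≤ ‖T‖ * ‖y‖ * ‖y‖ :=
      (abs_real_inner_le_norm _ _).trans
        (mul_le_mul_of_nonneg_right (T.le_opNorm y) (norm_nonneg _))
    have h2 : inner ℝ (T y) y = x ⬝ᵥ (B *ᵥ x) := by
      simp [hT, hy, EuclideanSpace.inner_eq_star_dotProduct]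
    have h3 : ‖y‖ * ‖y‖ = x ⬝ᵥ x := by
      rw [← real_inner_self_eq_norm_mul_norm]
      rw [hy, EuclideanSpace.inner_eq_star_dotProduct, star_trivial]
    rw [h2, mul_assoc, h3] at h1
    simp only [star_trivial, Matrix.add_mulVec, Matrix.smul_mulVec, Matrix.one_mulVec,
      dotProduct_add, dotProduct_smul, smul_eq_mul]
    linarith [neg_abs_le (x ⬝ᵥ (B *ᵥ x))]

open scoped MatrixOrder in
theorem exists_factor {n : ℕ} (P : Matrix (Fin n) (Fin n) ℝ) (hP : P.PosSemidef) :
    ∃ R : Matrix (Fin n) (Fin n) ℝ, P = Rᴴ * R :=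
  CStarAlgebra.nonneg_iff_eq_star_mul_self.mp hP.nonneg

/-- If `A` is symmetric and vanishes on `ker P`, then `tP + A ≥ 0` for some `t ≥ 0`. -/
theorem exists_smul_add_posSemidef {n : ℕ} (P A : Matrix (Fin n) (Fin n) ℝ)
    (hP : P.PosSemidef) (hA : A.IsHermitian) (hk : ∀ v, P *ᵥ v = 0 → A *ᵥ v = 0) :
    ∃ t : ℝ, 0 ≤ t ∧ (t • P + A).PosSemidef := by
  obtain ⟨R, rfl⟩ := exists_factor P hP
  obtain ⟨G, hG⟩ := exists_ginv R
  have h1 : A * (G * R) = A := by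
    have : A * (1 - G * R) = 0 := by
      apply Matrix.toLin'.injective
      refine LinearMap.ext fun x => ?_
      simp only [Matrix.toLin'_apply, ← Matrix.mulVec_mulVec, map_zero, LinearMap.zero_apply]
      apply hk
      rw [Matrix.mulVec_mulVec, mul_assoc, mul_sub, mul_one, ← mul_assoc R, hG, sub_self]
      simp
    rw [mul_sub, mul_one, sub_eq_zero] at this
    exact this.symm
  have h2 : (G * R)ᴴ * A = A := by
    have := congrArg Matrix.conjTranspose h1
    rwa [Matrix.conjTranspose_mul, hA.eq] at this
  obtain ⟨t, ht, hpos⟩ := exists_shift_posSemidef (Gᴴ * A * G)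
    (Matrix.isHermitian_conjTranspose_mul_mul G hA)
  refine ⟨t, ht, ?_⟩
  have := hpos.conjTranspose_mul_mul_same R
  have e : Rᴴ * (t • (1 : Matrix (Fin n) (Fin n) ℝ) + Gᴴ * A * G) * R = t • (Rᴴ * R) + A := by
    conv_rhs => rw [← h2, ← h1]
    simp [mul_add, add_mul, mul_assoc, Matrix.conjTranspose_mul]
  rwa [e] at this

open SymMat in
theorem symOn_ker {n : ℕ} (P A : SymMat n)
    (hA : A ∈ symOn ((LinearMap.ker (Matrix.toEuclideanLin (P : Matrix (Fin n) (Fin n) ℝ)))ᗮ))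
    (v : Fin n → ℝ) (hv : (P : Matrix (Fin n) (Fin n) ℝ) *ᵥ v = 0) :
    (A : Matrix (Fin n) (Fin n) ℝ) *ᵥ v = 0 := by
  set N := LinearMap.ker (Matrix.toEuclideanLin (P : Matrix (Fin n) (Fin n) ℝ)) with hN
  have hvN : WithLp.toLp 2 v ∈ N := by
    rw [hN, LinearMap.mem_ker, Matrix.toEuclideanLin_apply_piLp_toLp, hv]; rfl
  have h0 : Matrix.toEuclideanLin (projMat Nᗮ) (WithLp.toLp 2 v) = 0 := by
    rw [projMat, LinearEquiv.apply_symm_apply]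
    have : Submodule.orthogonalProjectionOnto Nᗮ (WithLp.toLp 2 v) = 0 := by
      rw [Submodule.orthogonalProjectionOnto_eq_zero_iff]
      exact Submodule.le_orthogonal_orthogonal N hvN
    simp [this]
  have h1 : projMat Nᗮ *ᵥ v = 0 := by
    have := congrArg WithLp.ofLp h0
    simpa using this
  have hA' : (A : Matrix (Fin n) (Fin n) ℝ) = projMat Nᗮ * A * projMat Nᗮ := hA
  rw [hA', ← Matrix.mulVec_mulVec, h1, Matrix.mulVec_zero]

open SymMat in
theorem symOn_mem {n : ℕ} (F : Set (SymMat n))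
    (hF : IsSubequation F) (P : SymMat n) (hP : P ∈ Psd n) (hPE : P ∈ edge F) (A : SymMat n)
    (hk : ∀ v, (P : Matrix (Fin n) (Fin n) ℝ) *ᵥ v = 0 →
      (A : Matrix (Fin n) (Fin n) ℝ) *ᵥ v = 0) : A ∈ F := by
  obtain ⟨t, ht, hpos⟩ := exists_smul_add_posSemidef (P : Matrix (Fin n) (Fin n) ℝ) A hP A.2 hk
  have h1 : t • (-P) ∈ F := hF.cone t ht _ hPE.2
  have h2 : t • P + A ∈ Psd n := hpos
  have := hF.positivity _ h1 _ h2
  have e : t • (-P) + (t • P + A) = A := by rw [smul_neg]; abel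
  rwa [e] at this

open SymMat in
theorem psd_mem_edge_symOn_subset {n : ℕ} (F : Set (SymMat n))
    (hF : IsSubequation F) (P : SymMat n) (hP : P ∈ Psd n) (hPE : P ∈ edge F) :
    symOn ((LinearMap.ker (Matrix.toEuclideanLin (P : Matrix (Fin n) (Fin n) ℝ)))ᗮ) ⊆ edge F := by
  intro A hA
  have hk := symOn_ker P A hA
  refine ⟨symOn_mem F hF P hP hPE A hk, symOn_mem F hF P hP hPE (-A) fun v hv => ?_⟩
  have h : ((-A : SymMat n) : Matrix (Fin n) (Fin n) ℝ) = -(A : Matrix (Fin n) (Fin n) ℝ) := rfl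
  rw [h, Matrix.neg_mulVec, hk v hv, neg_zero]
end
end

section
/- For a convex cone subequation F ⊆ Sym²(ℝⁿ) with polar cone F₊ and dual span S = span(F₊), the following are equivalent: (i) F is complete, i.e., F₊ is not contained in Sym²(W) for any proper subspace W ⊊ ℝⁿ; (ii) S ∩ Int 𝒫 ≠ ∅; (iii) Int_S F₊ ⊆ Int 𝒫, where Int_S F₊ denotes the interior of F₊ relative to the subspace S. -/
open Matrix Set Pointwise

noncomputable section

namespace SymMat

lemma pd_subset_interior (n : ℕ) (A : SymMat n) (hA : (A : Matrix (Fin n) (Fin n) ℝ).PosDef) :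
    A ∈ interior (Psd n) := by
  have hcont : Continuous (fun p : SymMat n × (Fin n → ℝ) =>
      p.2 ⬝ᵥ ((p.1 : Matrix (Fin n) (Fin n) ℝ) *ᵥ p.2)) := by
    apply Continuous.dotProduct continuous_snd
    exact Continuous.matrix_mulVec (continuous_subtype_val.comp continuous_fst) continuous_snd
  have hopen : IsOpen {p : SymMat n × (Fin n → ℝ) |
      0 < p.2 ⬝ᵥ ((p.1 : Matrix (Fin n) (Fin n) ℝ) *ᵥ p.2)} :=
    isOpen_lt continuous_const hcont
  obtain ⟨u, w, hu, -, hAu, hw, huw⟩ := generalized_tube_lemma (isCompact_singleton (x := A))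
    (isCompact_sphere (0 : Fin n → ℝ) 1) hopen (by
      rintro ⟨X, v⟩ ⟨hX, hv⟩
      have hX' : X = A := hX
      subst hX'
      have hv0 : v ≠ 0 := by
        rintro rfl
        simp at hv
      simpa using hA.dotProduct_mulVec_pos hv0)
  rw [mem_interior]
  refine ⟨u, ?_, hu, hAu rfl⟩
  intro X hX
  refine PosSemidef.of_dotProduct_mulVec_nonneg X.2 ?_
  intro v
  by_cases hv : v = 0
  · simp [hv]
  have hnv : 0 < ‖v‖ := norm_pos_iff.mpr hv
  have hs : (‖v‖⁻¹ • v) ∈ Metric.sphere (0 : Fin n → ℝ) 1 := by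
    simp [norm_smul, hnv.ne']
  have h := huw (show (X, ‖v‖⁻¹ • v) ∈ u ×ˢ w from ⟨hX, hw hs⟩)
  simp only [mem_setOf_eq, mulVec_smul, smul_dotProduct, dotProduct_smul, smul_eq_mul] at h
  have h2 : 0 < ‖v‖⁻¹ := inv_pos.mpr hnv
  have := (pos_of_mul_pos_right ((pos_of_mul_pos_right h h2.le)) h2.le)
  simpa using this.le

lemma interior_psd_pos {n : ℕ} {A : SymMat n} (hA : A ∈ interior (Psd n))
    {v : Fin n → ℝ} (hv : v ≠ 0) : 0 < v ⬝ᵥ ((A : Matrix (Fin n) (Fin n) ℝ) *ᵥ v) := by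
  have hc : Continuous (fun t : ℝ => A - t • (1 : SymMat n)) := by
    refine Continuous.subtype_mk (f := fun t : ℝ =>
      (A : Matrix (Fin n) (Fin n) ℝ) - t • (1 : Matrix (Fin n) (Fin n) ℝ)) ?_ _
    fun_prop
  have hev : ∀ᶠ t in nhds (0 : ℝ), A - t • (1 : SymMat n) ∈ Psd n := by
    have : Filter.Tendsto (fun t : ℝ => A - t • (1 : SymMat n)) (nhds 0) (nhds A) := by
      simpa using hc.tendsto 0
    exact this (mem_interior_iff_mem_nhds.mp hA)
  obtain ⟨ε, hε, h⟩ := Metric.eventually_nhds_iff.mp hev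
  have h1 := h (y := ε / 2) (by simp [abs_of_pos hε, hε])
  have h2 := PosSemidef.dotProduct_mulVec_nonneg h1 v
  have h3 : 0 < v ⬝ᵥ v := by
    have := dotProduct_star_self_pos_iff.mpr hv
    simpa using this
  simp [sub_mulVec, smul_mulVec] at h2
  nlinarith

lemma polar_psd {n : ℕ} {F : Set (SymMat n)} (hF : IsSubequation F) {B : SymMat n}
    (hB : B ∈ polarCone F) : (B : Matrix (Fin n) (Fin n) ℝ).PosSemidef := by
  refine PosSemidef.of_dotProduct_mulVec_nonneg B.2 ?_
  intro v
  obtain ⟨A, hA⟩ := hF.nonempty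
  have h0 : (0 : SymMat n) ∈ F := by simpa using hF.cone 0 le_rfl A hA
  have hp : lineProj (WithLp.toLp 2 v) ∈ Psd n := by
    have := posSemidef_vecMulVec_self_star v
    simpa [Psd, lineProj] using this
  have h1 := hF.positivity 0 h0 _ hp
  have h2 := hB _ h1
  have h3 : tinner (0 + lineProj (WithLp.toLp 2 v)) B =
      v ⬝ᵥ ((B : Matrix (Fin n) (Fin n) ℝ) *ᵥ v) := by
    have e : ((0 + lineProj (WithLp.toLp 2 v) : SymMat n) : Matrix (Fin n) (Fin n) ℝ)
      = vecMulVec v v := by simp [lineProj]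
    rw [tinner, e, trace_mul_comm, mul_vecMulVec, trace_vecMulVec, dotProduct_comm]
  rw [h3] at h2
  simpa using h2

lemma tinner_add_right {n : ℕ} (A B C : SymMat n) :
    tinner A (B + C) = tinner A B + tinner A C := by
  simp [tinner, mul_add]

lemma tinner_smul_right {n : ℕ} (A B : SymMat n) (t : ℝ) :
    tinner A (t • B) = t * tinner A B := by
  simp [tinner]

lemma polar_convex {n : ℕ} (F : Set (SymMat n)) : Convex ℝ (polarCone F) := by
  intro B hB C hC a b ha hb _ A hA
  rw [tinner_add_right, tinner_smul_right, tinner_smul_right]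
  have := hB A hA
  have := hC A hA
  positivity

lemma zero_mem_polar {n : ℕ} (F : Set (SymMat n)) : (0 : SymMat n) ∈ polarCone F := by
  intro A _
  simp [tinner]

lemma relInt_aux {V : Type*} [NormedAddCommGroup V] [NormedSpace ℝ V] [FiniteDimensional ℝ V]
    (s : Set V) (hs : Convex ℝ s) (h0 : (0 : V) ∈ s) :
    ∃ B, B ∈ Submodule.span ℝ s ∧ ∃ U : Set V, IsOpen U ∧ B ∈ U ∧
      U ∩ (Submodule.span ℝ s : Set V) ⊆ s := by
  have hsp : (affineSpan ℝ s : Set V) = Submodule.span ℝ s := by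
    have := affineSpan_insert_zero (k := ℝ) s
    rwa [Set.insert_eq_of_mem h0] at this
  obtain ⟨B, hB⟩ := Set.Nonempty.intrinsicInterior hs ⟨0, h0⟩
  obtain ⟨y, hy, rfl⟩ := mem_intrinsicInterior.mp hB
  obtain ⟨t, ht, hto, hyt⟩ := mem_interior.mp hy
  obtain ⟨U, hU, rfl⟩ := isOpen_induced_iff.mp hto
  refine ⟨y, ?_, U, hU, hyt, ?_⟩
  · have := y.2
    rw [← SetLike.mem_coe, hsp] at this
    exact this
  · rintro z ⟨hzU, hz⟩
    rw [← hsp] at hz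
    exact ht (show (⟨z, hz⟩ : affineSpan ℝ s) ∈ _ from hzU)

lemma relInt_nonempty {n : ℕ} (F : Set (SymMat n)) :
    (relInt ((Submodule.span ℝ (polarCone F) : Submodule ℝ (SymMat n)) : Set (SymMat n))
        (polarCone F)).Nonempty := by
  letI : NormedAddCommGroup (Matrix (Fin n) (Fin n) ℝ) := Matrix.normedAddCommGroup
  letI : NormedSpace ℝ (Matrix (Fin n) (Fin n) ℝ) := Matrix.normedSpace
  letI : NormedSpace ℝ (SymMat n) :=
    { (inferInstance : Module ℝ (SymMat n)) with
      norm_smul_le := fun a b => norm_smul_le a (b : Matrix (Fin n) (Fin n) ℝ) }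
  haveI : FiniteDimensional ℝ (SymMat n) :=
    FiniteDimensional.of_injective (V₂ := Matrix (Fin n) (Fin n) ℝ)
      { toFun := fun A => A, map_add' := fun _ _ => rfl, map_smul' := fun _ _ => rfl }
      Subtype.val_injective
  exact relInt_aux (polarCone F) (polar_convex F) (zero_mem_polar F)

lemma projMat_mulVec {n : ℕ} (W : Submodule ℝ (EuclideanSpace ℝ (Fin n))) (x : Fin n → ℝ) :
    projMat W *ᵥ x = WithLp.ofLp (W.starProjection (WithLp.toLp 2 x)) := by
  have h : Matrix.toEuclideanLin (projMat W) (WithLp.toLp 2 x)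
      = W.starProjection (WithLp.toLp 2 x) := by
    rw [projMat, LinearEquiv.apply_symm_apply]
    rfl
  rw [← h]
  simp

lemma mem_symOn_of_mulVec_eq_zero {n : ℕ} (C : SymMat n) (v : Fin n → ℝ)
    (h : (C : Matrix (Fin n) (Fin n) ℝ) *ᵥ v = 0) :
    C ∈ symOn (Submodule.span ℝ {WithLp.toLp 2 v})ᗮ := by
  change (C : Matrix (Fin n) (Fin n) ℝ) = _
  apply Matrix.ext_of_mulVec_single
  intro i
  generalize (Pi.single i 1 : Fin n → ℝ) = x
  rw [← mulVec_mulVec, ← mulVec_mulVec, projMat_mulVec _ x]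
  have h1 := Submodule.sub_starProjection_mem_orthogonal
    (K := (Submodule.span ℝ {WithLp.toLp 2 v})ᗮ) (WithLp.toLp 2 x)
  rw [Submodule.orthogonal_orthogonal, Submodule.mem_span_singleton] at h1
  obtain ⟨c, hc⟩ := h1
  have h2 : WithLp.ofLp ((Submodule.span ℝ {WithLp.toLp 2 v})ᗮ.starProjection (WithLp.toLp 2 x))
      = x - c • v := by
    have := congrArg WithLp.ofLp hc
    simp only [WithLp.ofLp_smul, WithLp.ofLp_sub] at this
    rw [this]; simp
  rw [h2, mulVec_sub, mulVec_smul, h, smul_zero, sub_zero, projMat_mulVec]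
  have h3 : WithLp.toLp 2 ((C : Matrix (Fin n) (Fin n) ℝ) *ᵥ x) ∈
      (Submodule.span ℝ {WithLp.toLp 2 v})ᗮ := by
    rw [Submodule.mem_orthogonal_singleton_iff_inner_right]
    have hT : (C : Matrix (Fin n) (Fin n) ℝ)ᵀ = C := by
      have := selfAdjoint.mem_iff.mp C.2
      rwa [star_eq_conjTranspose, conjTranspose_eq_transpose_of_trivial] at this
    simp only [EuclideanSpace.inner_toLp_toLp, star_trivial]
    rw [dotProduct_comm, dotProduct_mulVec, ← mulVec_transpose, hT, h, zero_dotProduct]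
  rw [Submodule.starProjection_eq_self_iff.mpr h3]

lemma span_subset_symOn {n : ℕ} {F : Set (SymMat n)}
    {W : Submodule ℝ (EuclideanSpace ℝ (Fin n))} (h : polarCone F ⊆ symOn W) :
    ((Submodule.span ℝ (polarCone F) : Submodule ℝ (SymMat n)) : Set (SymMat n)) ⊆ symOn W := by
  let K : Submodule ℝ (SymMat n) :=
    { carrier := symOn W
      zero_mem' := by simp [symOn]
      add_mem' := by
        intro a b ha hb
        simp only [symOn, mem_setOf_eq] at *
        rw [AddSubgroup.coe_add, mul_add, add_mul, ← ha, ← hb]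
      smul_mem' := by
        intro c a ha
        simp only [symOn, mem_setOf_eq] at *
        rw [selfAdjoint.val_smul, Matrix.mul_smul, Matrix.smul_mul, ← ha] }
  exact Submodule.span_le (p := K).mpr h

end SymMat

open SymMat in
theorem complete_tfae {n : ℕ} (F : Set (SymMat n)) (hF : IsSubequation F) :
    List.TFAE [
      SymMat.IsComplete F,
      (((Submodule.span ℝ (polarCone F) : Submodule ℝ (SymMat n)) : Set (SymMat n)) ∩
        interior (Psd n)).Nonempty,
      relInt ((Submodule.span ℝ (polarCone F) : Submodule ℝ (SymMat n)) : Set (SymMat n))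
        (polarCone F) ⊆ interior (Psd n)] := by
  tfae_have 2 → 1 := by
    rintro ⟨A, hAS, hA⟩ ⟨W, hW, hFW⟩
    have hAW : (A : Matrix (Fin n) (Fin n) ℝ) = projMat W * A * projMat W :=
      span_subset_symOn hFW hAS
    have hne : Wᗮ ≠ ⊥ := fun h => hW (Submodule.orthogonal_eq_bot_iff.mp h)
    obtain ⟨v, hv, hv0⟩ := Submodule.exists_mem_ne_zero_of_ne_bot hne
    have h1 : projMat W *ᵥ (WithLp.ofLp v) = 0 := by
      rw [projMat_mulVec]
      have : W.starProjection v = 0 := by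
        rw [Submodule.starProjection_apply_eq_zero_iff]; exact hv
      simp [this]
    have h2 : (A : Matrix (Fin n) (Fin n) ℝ) *ᵥ (WithLp.ofLp v) = 0 := by
      rw [hAW, ← mulVec_mulVec, h1, mulVec_zero]
    have h3 := interior_psd_pos hA (v := WithLp.ofLp v) (by simpa using hv0)
    rw [h2, dotProduct_zero] at h3
    exact lt_irrefl _ h3
  tfae_have 1 → 3 := by
    rintro hc B ⟨hBS, U, hU, hBU, hUF⟩
    have hB : B ∈ polarCone F := hUF ⟨hBU, hBS⟩
    have hBp := polar_psd hF hB
    by_contra hBi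
    have hex : ∃ v : Fin n → ℝ, v ≠ 0 ∧ v ⬝ᵥ ((B : Matrix (Fin n) (Fin n) ℝ) *ᵥ v) ≤ 0 := by
      by_contra! hall
      exact hBi (pd_subset_interior n B
        (PosDef.of_dotProduct_mulVec_pos B.2 (fun {v} hv => by simpa using hall v hv)))
    obtain ⟨v, hv0, hv⟩ := hex
    refine hc ⟨(Submodule.span ℝ {WithLp.toLp 2 v})ᗮ, ?_, ?_⟩
    · intro htop
      rw [Submodule.orthogonal_eq_top_iff, Submodule.span_singleton_eq_bot] at htop
      exact hv0 (by simpa using htop)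
    intro C hC
    apply mem_symOn_of_mulVec_eq_zero
    have hCp := polar_psd hF hC
    have hcont : Continuous (fun t : ℝ => B - t • C) := by
      refine Continuous.subtype_mk (f := fun t : ℝ =>
        (B : Matrix (Fin n) (Fin n) ℝ) - t • (C : Matrix (Fin n) (Fin n) ℝ)) ?_ _
      fun_prop
    have hev : ∀ᶠ t in nhds (0 : ℝ), B - t • C ∈ U := by
      have : Filter.Tendsto (fun t : ℝ => B - t • C) (nhds 0) (nhds B) := by
        simpa using hcont.tendsto 0
      exact this (hU.mem_nhds hBU)
    obtain ⟨ε, hε, h⟩ := Metric.eventually_nhds_iff.mp hev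
    have h1 := h (y := ε / 2) (by simp [abs_of_pos hε, hε])
    have h2 : B - (ε / 2) • C ∈ polarCone F := hUF ⟨h1, Submodule.sub_mem _ hBS
      (Submodule.smul_mem _ _ (Submodule.subset_span hC))⟩
    have h3 := (polar_psd hF h2).dotProduct_mulVec_nonneg v
    have h4 := hCp.dotProduct_mulVec_nonneg v
    simp [sub_mulVec, smul_mulVec] at h3 h4
    refine (hCp.dotProduct_mulVec_zero_iff v).mp ?_
    simp only [star_trivial]
    nlinarith
  tfae_have 3 → 2 := by
    intro h
    obtain ⟨B, hB⟩ := relInt_nonempty F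
    exact ⟨B, hB.1, h hB⟩
  tfae_finish
end
end

section
/- Let E ⊆ Sym²(ℝⁿ) be a linear subspace with E ∩ 𝒫 = {0}, and let π : Sym²(ℝⁿ) → E^⊥ be orthogonal projection onto the orthogonal complement of E. Then the image π(𝒫) is a closed convex cone, and consequently E + 𝒫 is a closed subset of Sym²(ℝⁿ). -/
open Matrix Set Pointwise

noncomputable section

/-- In a finite-dimensional normed space, the sum of a subspace and a closed cone that meet only
at the origin is closed. -/
lemma isClosed_submodule_add_cone {V : Type*} [NormedAddCommGroup V] [NormedSpace ℝ V]
    [FiniteDimensional ℝ V] (E : Submodule ℝ V) (P : Set V) (hP : IsClosed P)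
    (hc : ∀ t : ℝ, 0 ≤ t → ∀ p ∈ P, t • p ∈ P) (h : ∀ p ∈ P, p ∈ E → p = 0) :
    IsClosed ((E : Set V) + P) := by
  haveI : ProperSpace V := FiniteDimensional.proper ℝ V
  have hEc : IsClosed (E : Set V) := E.closed_of_finiteDimensional
  have hK : IsCompact (P ∩ Metric.sphere (0 : V) 1) := (isCompact_sphere 0 1).inter_left hP
  have hd : Disjoint (P ∩ Metric.sphere (0 : V) 1) (E : Set V) := by
    rw [Set.disjoint_left]
    rintro p ⟨hp, hs⟩ hpE
    rw [h p hp hpE] at hs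
    simp at hs
  obtain ⟨δ, hδ, hdis⟩ := hd.exists_thickenings hK hEc
  have key : ∀ e ∈ E, ∀ p ∈ P, δ * ‖p‖ ≤ ‖e + p‖ := by
    intro e he p hp
    by_cases hp0 : p = 0
    · simp [hp0]
    have hn : 0 < ‖p‖ := norm_pos_iff.mpr hp0
    by_contra! hlt
    have hk : (‖p‖⁻¹ • p) ∈ P ∩ Metric.sphere (0 : V) 1 := by
      refine ⟨hc _ (by positivity) p hp, ?_⟩
      simp [norm_smul, hn.ne']
    have hm : (-(‖p‖⁻¹ • e)) ∈ (E : Set V) := E.neg_mem (E.smul_mem _ he)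
    refine Set.disjoint_left.mp hdis (Metric.self_subset_thickening hδ _ hk) ?_
    rw [Metric.mem_thickening_iff]
    refine ⟨_, hm, ?_⟩
    rw [dist_eq_norm, sub_neg_eq_add, ← smul_add, norm_smul, norm_inv, norm_norm, add_comm p e,
      inv_mul_lt_iff₀ hn]
    linarith
  refine isClosed_of_closure_subset fun x hx => ?_
  have h1 : x ∈ closure (Metric.ball x 1 ∩ ((E : Set V) + P)) :=
    Metric.isOpen_ball.inter_closure ⟨Metric.mem_ball_self one_pos, hx⟩
  have hC : IsCompact (P ∩ Metric.closedBall (0 : V) ((‖x‖ + 1) / δ)) :=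
    (isCompact_closedBall _ _).inter_left hP
  have hcl := hEc.add_right_of_isCompact hC
  have hsub : Metric.ball x 1 ∩ ((E : Set V) + P) ⊆
      (E : Set V) + (P ∩ Metric.closedBall (0 : V) ((‖x‖ + 1) / δ)) := by
    rintro y ⟨hy, e, he, p, hp, rfl⟩
    refine ⟨e, he, p, ⟨hp, ?_⟩, rfl⟩
    rw [mem_closedBall_zero_iff, le_div_iff₀ hδ]
    have h2 := key e he p hp
    have h3 : ‖e + p - x‖ < 1 := by simpa [dist_eq_norm] using hy
    have h4 := norm_le_norm_add_norm_sub' (e + p) x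
    linarith
  exact Set.add_subset_add_left Set.inter_subset_left (closure_minimal hsub hcl h1)

attribute [local instance] Matrix.normedAddCommGroup Matrix.normedSpace in
lemma isClosed_matrix_add_psd {n : ℕ} (E : Submodule ℝ (Matrix (Fin n) (Fin n) ℝ))
    (h : ∀ p : Matrix (Fin n) (Fin n) ℝ, p.PosSemidef → p ∈ E → p = 0) :
    IsClosed ((E : Set (Matrix (Fin n) (Fin n) ℝ)) + {p | p.PosSemidef}) := by
  refine isClosed_submodule_add_cone E _ ?_ (fun t ht p hp => Matrix.PosSemidef.smul hp ht) h
  have : {p : Matrix (Fin n) (Fin n) ℝ | p.PosSemidef} =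
      {p | pᴴ = p} ∩ ⋂ x : Fin n → ℝ, {p | 0 ≤ star x ⬝ᵥ (p *ᵥ x)} := by
    ext p
    simp [Matrix.posSemidef_iff_dotProduct_mulVec, Matrix.IsHermitian]
  rw [this]
  refine (isClosed_eq (by fun_prop) (by fun_prop)).inter (isClosed_iInter fun x => ?_)
  exact isClosed_le (by fun_prop) (by fun_prop)

open SymMat in
lemma isClosed_add_psd {n : ℕ} (E : Submodule ℝ (SymMat n))
    (hE : (E : Set (SymMat n)) ∩ Psd n = {0}) : IsClosed ((E : Set (SymMat n)) + Psd n) := by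
  let ι : SymMat n →ₗ[ℝ] Matrix (Fin n) (Fin n) ℝ :=
    { toFun := fun A => A, map_add' := fun _ _ => rfl, map_smul' := fun _ _ => rfl }
  have h := isClosed_matrix_add_psd (E.map ι) (by
    rintro p hp ⟨A, hA, rfl⟩
    have : A ∈ (E : Set (SymMat n)) ∩ Psd n := ⟨hA, hp⟩
    rw [hE] at this
    rw [Set.mem_singleton_iff.mp this, map_zero])
  convert h.preimage (continuous_subtype_val :
    Continuous (Subtype.val : SymMat n → Matrix (Fin n) (Fin n) ℝ)) using 1
  ext A
  constructor
  · rintro ⟨e, he, p, hp, rfl⟩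
    exact ⟨ι e, ⟨e, he, rfl⟩, p, hp, rfl⟩
  · rintro ⟨_, ⟨e, he, rfl⟩, p, hp, hA⟩
    exact ⟨e, he, ⟨p, hp.isHermitian⟩, hp, Subtype.ext hA⟩

open SymMat in
theorem projection_psd_closed {n : ℕ} (E : Submodule ℝ (SymMat n))
    (hE : (E : Set (SymMat n)) ∩ Psd n = {0}) :
    (IsClosed (((E : Set (SymMat n)) + Psd n) ∩ orthSet (E : Set (SymMat n))) ∧
     Convex ℝ (((E : Set (SymMat n)) + Psd n) ∩ orthSet (E : Set (SymMat n))) ∧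
     (∀ t : ℝ, 0 ≤ t → ∀ A ∈ ((E : Set (SymMat n)) + Psd n) ∩ orthSet (E : Set (SymMat n)),
        t • A ∈ ((E : Set (SymMat n)) + Psd n) ∩ orthSet (E : Set (SymMat n)))) ∧
    IsClosed ((E : Set (SymMat n)) + Psd n) := by
  have hcl := isClosed_add_psd E hE
  have hadd : ∀ A ∈ ((E : Set (SymMat n)) + Psd n) ∩ orthSet (E : Set (SymMat n)),
      ∀ B ∈ ((E : Set (SymMat n)) + Psd n) ∩ orthSet (E : Set (SymMat n)),
      A + B ∈ ((E : Set (SymMat n)) + Psd n) ∩ orthSet (E : Set (SymMat n)) := by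
    rintro _ ⟨⟨e, he, p, hp, rfl⟩, h1⟩ _ ⟨⟨e', he', p', hp', rfl⟩, h2⟩
    refine ⟨⟨e + e', E.add_mem he he', p + p', Matrix.PosSemidef.add hp hp', ?_⟩, ?_⟩
    · exact add_add_add_comm _ _ _ _
    · intro C hC
      have e1 := h1 C hC
      have e2 := h2 C hC
      simp only [tinner, AddSubgroup.coe_add, mul_add, Matrix.trace_add] at e1 e2 ⊢
      linarith
  have hsmul : ∀ t : ℝ, 0 ≤ t →
      ∀ A ∈ ((E : Set (SymMat n)) + Psd n) ∩ orthSet (E : Set (SymMat n)),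
      t • A ∈ ((E : Set (SymMat n)) + Psd n) ∩ orthSet (E : Set (SymMat n)) := by
    rintro t ht _ ⟨⟨e, he, p, hp, rfl⟩, h1⟩
    refine ⟨⟨t • e, E.smul_mem t he, t • p, Matrix.PosSemidef.smul hp ht, ?_⟩, ?_⟩
    · exact (smul_add _ _ _).symm
    · intro C hC
      have e1 := h1 C hC
      simp only [tinner] at e1 ⊢
      rw [selfAdjoint.val_smul, Matrix.mul_smul, Matrix.trace_smul, e1, smul_zero]
  refine ⟨⟨hcl.inter ?_, ?_, hsmul⟩, hcl⟩
  · have : orthSet (E : Set (SymMat n)) = ⋂ A ∈ (E : Set (SymMat n)), {B | tinner A B = 0} := by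
      ext B
      simp [orthSet]
    rw [this]
    refine isClosed_biInter fun A _ => isClosed_eq ?_ continuous_const
    unfold tinner
    fun_prop
  · intro A hA B hB a b ha hb _
    exact hadd _ (hsmul a ha A hA) _ (hsmul b hb B hB)
end
end
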